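/- arXiv:2012.01628 — 6 statements merged into one kernel-verified Lean document; each statement's English description precedes it below -/
import Mathlib

section
/- Fix m, n ∈ ℕ, a node set Z = {z_{i,j} ∈ F² : (i,j) ≼ (m,n)}, and arbitrary values b_{i,j} ∈ F for all (i,j) ≼ (m,n). Then there exists a unique polynomial p ∈ Π²_{m,n} such that (Δ_x^i Δ_y^j p)(z_{i,j}) = b_{i,j} for all (i,j) ≼ (m,n). -/
open Finset

/-- The partial backward difference operator in the first variable:
`(Δ_x p)(x,y) = p(x,y) - p(x-1,y)`. -/
noncomputable def bdiffx {F : Type*} [Field F] (p : MvPolynomial (Fin 2) F) :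
    MvPolynomial (Fin 2) F :=
  p - MvPolynomial.aeval ![MvPolynomial.X 0 - 1, MvPolynomial.X 1] p

/-- The partial backward difference operator in the second variable:
`(Δ_y p)(x,y) = p(x,y) - p(x,y-1)`. -/
noncomputable def bdiffy {F : Type*} [Field F] (p : MvPolynomial (Fin 2) F) :
    MvPolynomial (Fin 2) F :=
  p - MvPolynomial.aeval ![MvPolynomial.X 0, MvPolynomial.X 1 - 1] p

/-- The upper (rising) factorial `t^{(0)} = 1`, `t^{(k)} = t(t+1)⋯(t+k-1)`,
in a commutative ring. -/
def upf {R : Type*} [CommRing R] (t : R) : ℕ → R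
  | 0 => 1
  | k + 1 => upf t k * (t + (k : R))

/-- `g` is the bivariate difference Gončarov polynomial `g̃_{m,n}((x,y); Z)` for
the node set `Z = {z_{i,j}}`: it is the unique polynomial of degree at most `m`
in `x` and at most `n` in `y` satisfying
`(Δ_x^i Δ_y^j g)(z_{i,j}) = m!·n!·δ_{i,m}·δ_{j,n}` for all `(i,j) ≼ (m,n)`. -/
def IsDiffGoncarov2 {F : Type*} [Field F] (m n : ℕ) (Z : ℕ → ℕ → F × F)
    (g : MvPolynomial (Fin 2) F) : Prop :=
  g.degreeOf 0 ≤ m ∧ g.degreeOf 1 ≤ n ∧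
    ∀ i ≤ m, ∀ j ≤ n,
      MvPolynomial.eval ![(Z i j).1, (Z i j).2] (bdiffx^[i] (bdiffy^[j] g)) =
        if i = m ∧ j = n then ((m.factorial : F) * (n.factorial : F)) else 0


lemma upf_shift {R : Type*} [CommRing R] (t : R) (k : ℕ) :
    upf (t - 1) (k + 1) = (t - 1) * upf t k := by
  induction k with
  | zero => simp [upf]
  | succ k ih =>
    rw [upf, ih, upf]
    push_cast
    ring

lemma upf_diff {R : Type*} [CommRing R] (t : R) (k : ℕ) :
    upf t k - upf (t - 1) k = k * upf t (k - 1) := by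
  cases k with
  | zero => simp [upf]
  | succ k =>
    rw [upf_shift, upf]
    push_cast
    ring

lemma map_upf {R S : Type*} [CommRing R] [CommRing S] (f : R →+* S) (t : R) (k : ℕ) :
    f (upf t k) = upf (f t) k := by
  induction k with
  | zero => simp [upf]
  | succ k ih => simp [upf, ih]

open MvPolynomial

/-- The basis polynomial `x^{(k)} y^{(l)}`. -/
noncomputable def bas (F : Type*) [Field F] (k l : ℕ) : MvPolynomial (Fin 2) F :=
  upf (X 0) k * upf (X 1) l

/-- `bdiffx` as a linear map. -/
noncomputable def dx (F : Type*) [Field F] :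
    MvPolynomial (Fin 2) F →ₗ[F] MvPolynomial (Fin 2) F :=
  LinearMap.id - (aeval ![X 0 - 1, X 1] :
    MvPolynomial (Fin 2) F →ₐ[F] MvPolynomial (Fin 2) F).toLinearMap

/-- `bdiffy` as a linear map. -/
noncomputable def dy (F : Type*) [Field F] :
    MvPolynomial (Fin 2) F →ₗ[F] MvPolynomial (Fin 2) F :=
  LinearMap.id - (aeval ![X 0, X 1 - 1] :
    MvPolynomial (Fin 2) F →ₐ[F] MvPolynomial (Fin 2) F).toLinearMap

lemma bdiffx_eq {F : Type*} [Field F] : (bdiffx : MvPolynomial (Fin 2) F → _) = dx F := by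
  ext1 p; simp [bdiffx, dx]

lemma bdiffy_eq {F : Type*} [Field F] : (bdiffy : MvPolynomial (Fin 2) F → _) = dy F := by
  ext1 p; simp [bdiffy, dy]

lemma dx_bas {F : Type*} [Field F] (k l : ℕ) :
    dx F (bas F k l) = (k : F) • bas F (k - 1) l := by
  have h1 := map_upf (aeval ![X 0 - 1, X 1] :
    MvPolynomial (Fin 2) F →ₐ[F] MvPolynomial (Fin 2) F).toRingHom (X 0) k
  have h2 := map_upf (aeval ![X 0 - 1, X 1] :
    MvPolynomial (Fin 2) F →ₐ[F] MvPolynomial (Fin 2) F).toRingHom (X 1) l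
  simp at h1 h2
  have h3 := upf_diff (X 0 : MvPolynomial (Fin 2) F) k
  simp only [dx, bas, LinearMap.sub_apply, LinearMap.id_apply, AlgHom.toLinearMap_apply, map_mul,
    aeval_eq_bind₁, h1, h2, smul_eq_C_mul, map_natCast]
  linear_combination (upf (X 1) l) * h3

lemma dy_bas {F : Type*} [Field F] (k l : ℕ) :
    dy F (bas F k l) = (l : F) • bas F k (l - 1) := by
  have h1 := map_upf (aeval ![X 0, X 1 - 1] :
    MvPolynomial (Fin 2) F →ₐ[F] MvPolynomial (Fin 2) F).toRingHom (X 0) k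
  have h2 := map_upf (aeval ![X 0, X 1 - 1] :
    MvPolynomial (Fin 2) F →ₐ[F] MvPolynomial (Fin 2) F).toRingHom (X 1) l
  simp at h1 h2
  have h3 := upf_diff (X 1 : MvPolynomial (Fin 2) F) l
  simp only [dy, bas, LinearMap.sub_apply, LinearMap.id_apply, AlgHom.toLinearMap_apply, map_mul,
    aeval_eq_bind₁, h1, h2, smul_eq_C_mul, map_natCast]
  linear_combination (upf (X 0) k) * h3

lemma dx_pow_bas {F : Type*} [Field F] (i k l : ℕ) :
    (dx F ^ i) (bas F k l) = (k.descFactorial i : F) • bas F (k - i) l := by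
  induction i with
  | zero => simp
  | succ i ih =>
    rw [pow_succ', Module.End.mul_apply, ih, map_smul, dx_bas, smul_smul,
      Nat.descFactorial_succ, Nat.sub_sub]
    push_cast
    rw [mul_comm]

lemma dy_pow_bas {F : Type*} [Field F] (i k l : ℕ) :
    (dy F ^ i) (bas F k l) = (l.descFactorial i : F) • bas F k (l - i) := by
  induction i with
  | zero => simp
  | succ i ih =>
    rw [pow_succ', Module.End.mul_apply, ih, map_smul, dy_bas, smul_smul,
      Nat.descFactorial_succ, Nat.sub_sub]
    push_cast
    rw [mul_comm]

lemma degreeOf_upf {F : Type*} [Field F] (s t : Fin 2) (k : ℕ) :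
    degreeOf s (upf (X t : MvPolynomial (Fin 2) F) k) ≤ if s = t then k else 0 := by
  induction k with
  | zero => simp [upf]
  | succ k ih =>
    rw [upf]
    refine (degreeOf_mul_le _ _ _).trans ?_
    have h : degreeOf s (X t + (k : MvPolynomial (Fin 2) F)) ≤ if s = t then 1 else 0 := by
      refine (degreeOf_add_le _ _ _).trans ?_
      rw [← map_natCast (C : F →+* MvPolynomial (Fin 2) F), degreeOf_C, degreeOf_X]
      simp
    split_ifs at * <;> omega

/-- The space `Π²_{m,n}`. -/
noncomputable def Vmn (F : Type*) [Field F] (m n : ℕ) : Submodule F (MvPolynomial (Fin 2) F) where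
  carrier := {p | p.degreeOf 0 ≤ m ∧ p.degreeOf 1 ≤ n}
  zero_mem' := by simp
  add_mem' := fun {a b} ha hb =>
    ⟨(degreeOf_add_le _ _ _).trans (max_le ha.1 hb.1),
      (degreeOf_add_le _ _ _).trans (max_le ha.2 hb.2)⟩
  smul_mem' := fun c p hp => by
    rw [smul_eq_C_mul]
    exact ⟨(degreeOf_C_mul_le _ _ _).trans hp.1, (degreeOf_C_mul_le _ _ _).trans hp.2⟩

lemma bas_mem {F : Type*} [Field F] {m n k l : ℕ} (hk : k ≤ m) (hl : l ≤ n) :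
    bas F k l ∈ Vmn F m n := by
  constructor
  · refine (degreeOf_mul_le _ _ _).trans ?_
    have h1 := degreeOf_upf (F := F) 0 0 k
    have h2 := degreeOf_upf (F := F) 0 1 l
    simp at h1 h2
    omega
  · refine (degreeOf_mul_le _ _ _).trans ?_
    have h1 := degreeOf_upf (F := F) 1 0 k
    have h2 := degreeOf_upf (F := F) 1 1 l
    simp at h1 h2
    omega

/-- Coefficient map. -/
noncomputable def coefMap (F : Type*) [Field F] (m n : ℕ) :
    Vmn F m n →ₗ[F] (Fin (m + 1) × Fin (n + 1) → F) :=
  (LinearMap.pi fun ij => lcoeff F (Finsupp.single 0 (ij.1 : ℕ) + Finsupp.single 1 (ij.2 : ℕ))) ∘ₗ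
    (Vmn F m n).subtype

lemma coefMap_inj (F : Type*) [Field F] (m n : ℕ) : Function.Injective (coefMap F m n) := by
  rw [← LinearMap.ker_eq_bot, LinearMap.ker_eq_bot']
  rintro ⟨p, hp0, hp1⟩ h
  ext d
  simp only [ZeroMemClass.coe_zero, coeff_zero]
  by_contra hd
  have h0 := (monomial_le_degreeOf 0 (mem_support_iff.mpr hd)).trans hp0
  have h1 := (monomial_le_degreeOf 1 (mem_support_iff.mpr hd)).trans hp1
  have := congrFun h (⟨d 0, by omega⟩, ⟨d 1, by omega⟩)
  apply hd
  have hdd : d = Finsupp.single 0 (d 0) + Finsupp.single 1 (d 1) := by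
    ext i; fin_cases i <;> simp
  rw [hdd]
  simpa [coefMap] using this

/-- Interpolation functional map on all polynomials. -/
noncomputable def interp (F : Type*) [Field F] (m n : ℕ) (Z : ℕ → ℕ → F × F) :
    MvPolynomial (Fin 2) F →ₗ[F] (Fin (m + 1) × Fin (n + 1) → F) :=
  LinearMap.pi fun ij =>
    (aeval ![(Z ij.1 ij.2).1, (Z ij.1 ij.2).2] : MvPolynomial (Fin 2) F →ₐ[F] F).toLinearMap ∘ₗ
      (dx F ^ (ij.1 : ℕ)) ∘ₗ (dy F ^ (ij.2 : ℕ))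

lemma interp_apply {F : Type*} [Field F] (m n : ℕ) (Z : ℕ → ℕ → F × F)
    (p : MvPolynomial (Fin 2) F) (ij : Fin (m + 1) × Fin (n + 1)) :
    interp F m n Z p ij = eval ![(Z ij.1 ij.2).1, (Z ij.1 ij.2).2]
      (bdiffx^[(ij.1 : ℕ)] (bdiffy^[(ij.2 : ℕ)] p)) := by
  simp [interp, bdiffx_eq, bdiffy_eq, Module.End.pow_apply, aeval_eq_eval]

/-- Synthesis map. -/
noncomputable def syn (F : Type*) [Field F] (m n : ℕ) :
    (Fin (m + 1) × Fin (n + 1) → F) →ₗ[F] MvPolynomial (Fin 2) F :=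
  Fintype.linearCombination F fun kl => bas F kl.1 kl.2

lemma syn_mem {F : Type*} [Field F] (m n : ℕ) (c) : syn F m n c ∈ Vmn F m n := by
  rw [syn, Fintype.linearCombination_apply]
  refine Submodule.sum_mem _ fun kl _ => Submodule.smul_mem _ _ (bas_mem ?_ ?_) <;> omega

lemma interp_bas {F : Type*} [Field F] (m n : ℕ) (Z : ℕ → ℕ → F × F)
    (k l : ℕ) (ij : Fin (m + 1) × Fin (n + 1)) :
    interp F m n Z (bas F k l) ij = (l.descFactorial ij.2 : F) * ((k.descFactorial ij.1 : F) *
      aeval ![(Z ij.1 ij.2).1, (Z ij.1 ij.2).2] (bas F (k - ij.1) (l - ij.2))) := by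
  simp only [interp, LinearMap.pi_apply, LinearMap.comp_apply, dy_pow_bas, map_smul, dx_pow_bas,
    smul_eq_mul, AlgHom.toLinearMap_apply]

lemma interp_syn_inj (F : Type*) [Field F] [CharZero F] (m n : ℕ) (Z : ℕ → ℕ → F × F) :
    Function.Injective (interp F m n Z ∘ₗ syn F m n) := by
  classical
  rw [← LinearMap.ker_eq_bot, LinearMap.ker_eq_bot']
  intro c hc
  by_contra hne
  obtain ⟨a, ha⟩ := Function.ne_iff.mp hne
  obtain ⟨kl, hkl⟩ := (Set.toFinite {a | c a ≠ 0}).exists_maximal ⟨a, ha⟩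
  have h := congrFun hc kl
  rw [LinearMap.comp_apply, syn, Fintype.linearCombination_apply, map_sum, Finset.sum_apply,
    Finset.sum_eq_single kl] at h
  · rw [map_smul, Pi.smul_apply, interp_bas] at h
    simp [bas, upf, Nat.descFactorial_self, Nat.factorial_ne_zero] at h
    exact hkl.1 h
  · intro b _ hb
    rw [map_smul, Pi.smul_apply, interp_bas]
    by_cases hcb : c b = 0
    · simp [hcb]
    by_cases h1 : (b.1 : ℕ) < kl.1
    · simp [Nat.descFactorial_eq_zero_iff_lt.mpr h1]
    by_cases h2 : (b.2 : ℕ) < kl.2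
    · simp [Nat.descFactorial_eq_zero_iff_lt.mpr h2]
    have hle : kl ≤ b := ⟨not_lt.mp h1, not_lt.mp h2⟩
    exact absurd (le_antisymm (hkl.2 hcb hle) hle) hb
  · simp

/-- **Bivariate Gončarov interpolation with difference operators.**
For any node set `Z` and prescribed values `b_{i,j}` for `(i,j) ≼ (m,n)`, there is a
unique polynomial `p ∈ Π²_{m,n}` with `(Δ_x^i Δ_y^j p)(z_{i,j}) = b_{i,j}` for all
`(i,j) ≼ (m,n)`. -/
theorem bivariate_goncarov_interpolation (F : Type*) [Field F] [CharZero F]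
    (m n : ℕ) (Z : ℕ → ℕ → F × F) (b : ℕ → ℕ → F) :
    ∃! p : MvPolynomial (Fin 2) F,
      p.degreeOf 0 ≤ m ∧ p.degreeOf 1 ≤ n ∧
        ∀ i ≤ m, ∀ j ≤ n,
          MvPolynomial.eval ![(Z i j).1, (Z i j).2] (bdiffx^[i] (bdiffy^[j] p)) = b i j := by
  have hsurj : Function.Surjective (interp F m n Z ∘ₗ syn F m n) :=
    LinearMap.injective_iff_surjective.mp (interp_syn_inj F m n Z)
  have hfin : FiniteDimensional F (Vmn F m n) :=
    FiniteDimensional.of_injective _ (coefMap_inj F m n)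
  have hTs : Function.Surjective (interp F m n Z ∘ₗ (Vmn F m n).subtype) := by
    intro w
    obtain ⟨c, hc⟩ := hsurj w
    exact ⟨⟨syn F m n c, syn_mem m n c⟩, hc⟩
  have hrank : Module.finrank F (Vmn F m n) =
      Module.finrank F (Fin (m + 1) × Fin (n + 1) → F) :=
    le_antisymm (LinearMap.finrank_le_finrank_of_injective (coefMap_inj F m n))
      (LinearMap.finrank_le_finrank_of_surjective hTs)
  have hTi := (LinearMap.injective_iff_surjective_of_finrank_eq_finrank hrank).mpr hTs
  have key : ∀ p : MvPolynomial (Fin 2) F, (∀ i ≤ m, ∀ j ≤ n,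
      MvPolynomial.eval ![(Z i j).1, (Z i j).2] (bdiffx^[i] (bdiffy^[j] p)) = b i j) ↔
      interp F m n Z p = fun ij => b ij.1 ij.2 := by
    intro p
    constructor
    · intro h
      ext ij
      rw [interp_apply]
      exact h _ (by omega) _ (by omega)
    · intro h i hi j hj
      have := congrFun h (⟨i, by omega⟩, ⟨j, by omega⟩)
      rwa [interp_apply] at this
  obtain ⟨p, hp⟩ := hTs fun ij => b ij.1 ij.2
  refine ⟨p, ⟨p.2.1, p.2.2, (key _).mpr hp⟩, ?_⟩
  rintro q ⟨hq0, hq1, hq⟩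
  have : (⟨q, hq0, hq1⟩ : Vmn F m n) = p := hTi (((key q).mp hq).trans hp.symm)
  rw [← this]
end

section
/- (Determinant formula) For n ≥ 1 and nodes a_0, …, a_{n−1} ∈ F, the polynomial g̃_n(x; a_0, …, a_{n−1}) equals n!·det M, where M is the (n+1)×(n+1) matrix over F[x] with rows and columns indexed by 0, …, n whose (i,j)-entry is a_i^{(j−i)}/(j−i)! if 0 ≤ i ≤ j and i ≤ n−1, is x^{(j)}/j! if i = n, and is 0 otherwise (i.e., when j < i ≤ n−1). -/
open Polynomial Finset

/-- The backward difference operator `(Δ p)(x) = p(x) - p(x-1)` on `F[x]`. -/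
noncomputable def bdiff {F : Type*} [Field F] (p : F[X]) : F[X] :=
  p - p.comp (X - C 1)

/-- `g` is the `n`-th univariate difference Gončarov polynomial
`g̃_n(x; a_0, …, a_{n-1})` for the nodes `a`: it is the unique polynomial of
degree `n` satisfying the biorthogonality conditions `(Δ^s g)(a_s) = n!·δ_{s,n}`
for `0 ≤ s ≤ n`.  (For `s = n` the condition says that the constant polynomial
`Δ^n g` equals `n!`; together with `natDegree g ≤ n` this forces the degree to
be exactly `n`.)  Only the nodes `a_0, …, a_{n-1}` are used. -/
def IsDiffGoncarov {F : Type*} [Field F] (n : ℕ) (a : ℕ → F) (g : F[X]) : Prop :=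
  g.natDegree ≤ n ∧ (∀ s < n, (bdiff^[s] g).eval (a s) = 0) ∧
    bdiff^[n] g = C (n.factorial : F)


namespace GonAux

variable {F : Type*} [Field F]

noncomputable def D : F[X] →ₗ[F] F[X] where
  toFun := bdiff
  map_add' p q := by simp only [bdiff, add_comp]; ring
  map_smul' c p := by simp only [bdiff, smul_comp, smul_sub, RingHom.id_apply]

noncomputable def e (j : ℕ) : F[X] := C ((j.factorial : F)⁻¹) * upf (X : F[X]) j

lemma upf_comp (p : F[X]) (k : ℕ) : (upf (X : F[X]) k).comp p = upf p k := by
  induction k with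
  | zero => simp [upf]
  | succ k ih => simp [upf, ih]

lemma upf_eval (a : F) (k : ℕ) : (upf (X : F[X]) k).eval a = upf a k := by
  induction k with
  | zero => simp [upf]
  | succ k ih => simp [upf, ih]

lemma upf_shift {R : Type*} [CommRing R] (t : R) (k : ℕ) :
    upf (t - 1) (k + 1) = (t - 1) * upf t k := by
  induction k with
  | zero => simp [upf]
  | succ k ih => rw [upf, ih, upf]; push_cast; ring

lemma bdiff_e_zero : bdiff (e 0 : F[X]) = 0 := by
  simp [bdiff, e, upf]

lemma bdiff_e_succ [CharZero F] (j : ℕ) : bdiff (e (j + 1) : F[X]) = e j := by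
  have h : (((j + 1).factorial : F)⁻¹) * ((j : F) + 1) = ((j.factorial : F)⁻¹) := by
    have h1 : (j.factorial : F) ≠ 0 := by exact_mod_cast j.factorial_ne_zero
    have h2 : ((j : F) + 1) ≠ 0 := by exact_mod_cast j.succ_ne_zero
    rw [Nat.factorial_succ]; push_cast; field_simp
  unfold e bdiff
  rw [← h, mul_comp, C_comp, upf_comp, C_1, upf_shift, upf]
  simp only [C_mul, C_add, C_1, map_natCast]
  ring

lemma iter_e [CharZero F] (s j : ℕ) :
    bdiff^[s] (e j : F[X]) = if s ≤ j then e (j - s) else 0 := by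
  induction s generalizing j with
  | zero => simp
  | succ s ih =>
    rw [Function.iterate_succ_apply]
    cases j with
    | zero =>
      rw [bdiff_e_zero]
      have : bdiff^[s] (0 : F[X]) = 0 := Function.iterate_fixed (by simp [bdiff]) s
      simp [this]
    | succ j => rw [bdiff_e_succ, ih]; simp

lemma iter_sum [CharZero F] (s m : ℕ) (c : ℕ → F) :
    bdiff^[s] (∑ j ∈ range m, C (c j) * e j : F[X])
      = ∑ j ∈ range m, C (c j) * bdiff^[s] (e j) := by
  have h : ∀ p : F[X], bdiff^[s] p = (D ^ s) p := fun p => by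
    rw [Module.End.pow_apply]; rfl
  simp only [h, map_sum, ← smul_eq_C_mul, map_smul]

lemma const_of_bdiff [CharZero F] (h : F[X]) (hh : bdiff h = 0) : h = C (h.eval 0) := by
  have h1 : h = h.comp (X - C 1) := sub_eq_zero.mp hh
  have h2 : ∀ m : ℕ, h.eval (-(m : F)) = h.eval 0 := by
    intro m
    induction m with
    | zero => simp
    | succ m ih =>
      rw [← ih]
      conv_rhs => rw [h1]
      rw [eval_comp]
      congr 1
      simp
      ring
  apply eq_of_infinite_eval_eq
  refine Set.Infinite.mono ?_ (Set.infinite_range_of_injective (f := fun m : ℕ => -(m : F)) ?_)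
  · rintro _ ⟨m, rfl⟩
    simp [h2]
  · intro x y hxy
    simpa using hxy

lemma expand [CharZero F] (n : ℕ) (g : F[X]) (k : F) (hg : bdiff^[n] g = C k) :
    ∃ c : ℕ → F, c n = k ∧ g = ∑ j ∈ range (n + 1), C (c j) * e j := by
  induction n generalizing g with
  | zero => exact ⟨fun _ => k, rfl, by simpa [e, upf] using hg⟩
  | succ n ih =>
    obtain ⟨c, hc, hs⟩ := ih (bdiff g) (by rwa [Function.iterate_succ_apply] at hg)
    have h0 : bdiff (g - ∑ j ∈ range (n + 1), C (c j) * e (j + 1)) = 0 := by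
      change D _ = 0
      rw [map_sub, map_sum]
      simp only [← smul_eq_C_mul, map_smul]
      change bdiff g - ∑ j ∈ range (n + 1), c j • bdiff (e (j + 1)) = 0
      simp only [bdiff_e_succ, smul_eq_C_mul]
      rw [hs, sub_self]
    have h1 := const_of_bdiff _ h0
    generalize eval (0 : F) _ = d at h1
    refine ⟨fun j => Nat.casesOn j d c, hc, ?_⟩
    rw [sum_range_succ', ← sub_eq_iff_eq_add', h1]
    simp [e, upf]

end GonAux

/-- **Determinant formula.** For `n ≥ 1` and nodes `a_0, …, a_{n-1}`, the difference
Gončarov polynomial `g̃_n(x; a_0, …, a_{n-1})` equals `n! · det M`, where `M` is the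
`(n+1) × (n+1)` matrix whose `(i,j)`-entry is `a_i^{(j-i)}/(j-i)!` when `0 ≤ i ≤ j`
and `i ≤ n-1`, is `x^{(j)}/j!` when `i = n`, and is `0` otherwise. -/
theorem determinant_formula (F : Type*) [Field F] [CharZero F] (n : ℕ) (hn : 1 ≤ n)
    (a : ℕ → F) (g : F[X]) (hg : IsDiffGoncarov n a g) :
    g = C (n.factorial : F) *
      (Matrix.of fun i j : Fin (n + 1) =>
        if (i : ℕ) = n then C (((j : ℕ).factorial : F)⁻¹) * upf (X : F[X]) (j : ℕ)
        else if (i : ℕ) ≤ (j : ℕ) then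
          C (upf (a (i : ℕ)) ((j : ℕ) - (i : ℕ)) / (((j : ℕ) - (i : ℕ)).factorial : F))
        else 0).det := by
  obtain ⟨-, h0, hn'⟩ := hg
  obtain ⟨c, hc, hs⟩ := GonAux.expand n g _ hn'
  set M : Matrix (Fin (n + 1)) (Fin (n + 1)) F[X] := Matrix.of fun i j : Fin (n + 1) =>
        if (i : ℕ) = n then C (((j : ℕ).factorial : F)⁻¹) * upf (X : F[X]) (j : ℕ)
        else if (i : ℕ) ≤ (j : ℕ) then
          C (upf (a (i : ℕ)) ((j : ℕ) - (i : ℕ)) / (((j : ℕ) - (i : ℕ)).factorial : F))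
        else 0 with hM
  have hv : M.mulVec (fun j => C (c j)) = Pi.single (Fin.last n) g := by
    funext i
    rw [Matrix.mulVec, dotProduct]
    by_cases hi : (i : ℕ) = n
    · have : i = Fin.last n := Fin.ext hi
      subst this
      rw [Pi.single_eq_same]
      conv_rhs => rw [hs, Finset.sum_range]
      refine Finset.sum_congr rfl fun j _ => ?_
      simp [hM, GonAux.e, mul_comm]
    · have hne : i ≠ Fin.last n := fun h => hi (by simp [h])
      rw [Pi.single_eq_of_ne hne]
      have h1 := h0 i (by omega)
      rw [hs, GonAux.iter_sum, eval_finsetSum, Finset.sum_range] at h1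
      have h2 := congrArg (C : F →+* F[X]) h1
      rw [map_sum, C_0] at h2
      rw [← h2]
      refine Finset.sum_congr rfl fun j _ => ?_
      rw [GonAux.iter_e, hM, Matrix.of_apply, if_neg hi]
      split_ifs with hij
      · rw [GonAux.e, eval_mul, eval_mul, eval_C, eval_C, GonAux.upf_eval, ← C_mul]
        congr 1
        ring
      · simp
  have hadj : M.adjugate (Fin.last n) (Fin.last n) = 1 := by
    rw [Matrix.adjugate_fin_succ_eq_det_submatrix, Matrix.det_of_isUpperTriangular]
    · simp only [Fin.val_last, ← two_mul, pow_mul]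
      simp [hM, upf, Fin.succAbove_last, (Fin.is_lt _).ne]
    · intro i j hij
      have hij' : (j : ℕ) < i := hij
      simp [hM, Fin.succAbove_last, i.is_lt.ne]
      intro h
      exact absurd hij' (not_lt.mpr h)
  have h3 := congrArg (fun v => M.adjugate.mulVec v (Fin.last n)) hv
  simp only [Matrix.mulVec_mulVec, Matrix.adjugate_mul, Matrix.smul_mulVec, Matrix.one_mulVec,
    Matrix.mulVec_single] at h3
  simp [hadj, hc] at h3
  rw [← h3]
  simp [mul_comm]
end

section
/- (Difference relation and characterization) Let a_0, a_1, a_2, … ∈ F be an infinite sequence of nodes. Then for all n ≥ 1 and k ≥ 0, Δ g̃_n(x; a_k, a_{k+1}, …, a_{k+n−1}) = n · g̃_{n−1}(x; a_{k+1}, …, a_{k+n−1}), and g̃_n(a_k; a_k, …, a_{k+n−1}) = δ_{0,n}. Conversely, if f_{n,k} ∈ F[x] (n, k ∈ ℕ) is any family of polynomials satisfying Δ f_{n,k} = n · f_{n−1,k+1} for all n ≥ 1 and f_{n,k}(a_k) = δ_{0,n} for all n, k, then f_{n,k} = g̃_n(x; a_k, a_{k+1}, …, a_{k+n−1}) for all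 n, k. -/
open Polynomial Finset

lemma bdiff_sub {F : Type*} [Field F] (p q : F[X]) : bdiff (p - q) = bdiff p - bdiff q := by
  simp only [bdiff, sub_comp]; ring

lemma bdiff_C_mul {F : Type*} [Field F] (c : F) (p : F[X]) :
    bdiff (C c * p) = C c * bdiff p := by
  simp only [bdiff, mul_comp, C_comp]; ring

lemma bdiff_iter_sub {F : Type*} [Field F] (s : ℕ) (p q : F[X]) :
    bdiff^[s] (p - q) = bdiff^[s] p - bdiff^[s] q := by
  induction s generalizing p q with
  | zero => rfl
  | succ s ih => simp only [Function.iterate_succ_apply, bdiff_sub, ih]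

lemma bdiff_iter_C_mul {F : Type*} [Field F] (s : ℕ) (c : F) (p : F[X]) :
    bdiff^[s] (C c * p) = C c * bdiff^[s] p := by
  induction s generalizing p with
  | zero => rfl
  | succ s ih => simp only [Function.iterate_succ_apply, bdiff_C_mul, ih]

/-- A polynomial with vanishing difference and one zero is zero. -/
lemma eq_zero_of_bdiff {F : Type*} [Field F] [CharZero F] (p : F[X]) (c : F)
    (h : bdiff p = 0) (hc : p.eval c = 0) : p = 0 := by
  have hr : ∀ n : ℕ, p.eval (c + n) = 0 := by
    intro n
    induction n with
    | zero => simpa using hc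
    | succ n ih =>
      have h2 := congrArg (eval (c + (n + 1 : ℕ))) h
      have h3 : c + ((n : F) + 1) - 1 = c + n := by ring
      simp [bdiff, eval_comp, h3, ih] at h2
      simpa using h2
  apply Polynomial.eq_zero_of_infinite_isRoot
  refine Set.Infinite.mono ?_ (Set.infinite_range_of_injective (f := fun n : ℕ => c + (n : F)) ?_)
  · rintro _ ⟨n, rfl⟩
    exact hr n
  · intro m n hmn
    simpa using hmn

lemma eq_zero_of_iter {F : Type*} [Field F] [CharZero F] (n : ℕ) (b : ℕ → F) (p : F[X])
    (h : ∀ s < n, (bdiff^[s] p).eval (b s) = 0) (hn : bdiff^[n] p = 0) : p = 0 := by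
  induction n generalizing b p with
  | zero => simpa using hn
  | succ n ih =>
    refine eq_zero_of_bdiff p (b 0) ?_ (h 0 (Nat.succ_pos n))
    exact ih (fun i => b (i + 1)) (bdiff p) (fun s hs => h (s + 1) (by omega)) hn

/-- **Difference relation and characterization.** For an infinite sequence of nodes
`a_0, a_1, …`, write `G n k` for `g̃_n(x; a_k, a_{k+1}, …, a_{k+n-1})`.  Then
`Δ G n k = n · G (n-1) (k+1)` for `n ≥ 1`, and `(G n k)(a_k) = δ_{0,n}`.
Conversely, any family `f n k` of polynomials (the `n`-th of degree at most `n`)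
satisfying these two relations coincides with the family of difference Gončarov
polynomials. -/
theorem difference_relation_characterization (F : Type*) [Field F] [CharZero F]
    (a : ℕ → F) (G : ℕ → ℕ → F[X])
    (hG : ∀ n k, IsDiffGoncarov n (fun i => a (k + i)) (G n k)) :
    (∀ n, 1 ≤ n → ∀ k, bdiff (G n k) = C (n : F) * G (n - 1) (k + 1)) ∧
    (∀ n k, (G n k).eval (a k) = if n = 0 then 1 else 0) ∧
    (∀ f : ℕ → ℕ → F[X],
      (∀ n k, (f n k).natDegree ≤ n) →
      (∀ n, 1 ≤ n → ∀ k, bdiff (f n k) = C (n : F) * f (n - 1) (k + 1)) →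
      (∀ n k, (f n k).eval (a k) = if n = 0 then 1 else 0) →
      ∀ n k, f n k = G n k) := by
  have h1 : ∀ n, 1 ≤ n → ∀ k, bdiff (G n k) = C (n : F) * G (n - 1) (k + 1) := by
    intro n hn k
    obtain ⟨m, rfl⟩ : ∃ m, n = m + 1 := ⟨n - 1, by omega⟩
    rw [Nat.add_sub_cancel, ← sub_eq_zero]
    obtain ⟨-, hA, hB⟩ := hG (m + 1) k
    obtain ⟨-, hA', hB'⟩ := hG m (k + 1)
    apply eq_zero_of_iter m (fun i => a (k + 1 + i))
    · intro s hs
      have e1 := hA (s + 1) (by omega)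
      have e2 := hA' s hs
      rw [Function.iterate_succ_apply] at e1
      have e3 : k + 1 + s = k + (s + 1) := by omega
      simp only [e3] at e2 ⊢
      rw [bdiff_iter_sub, bdiff_iter_C_mul, eval_sub, eval_mul, e1, e2]
      simp
    · rw [Function.iterate_succ_apply] at hB
      rw [bdiff_iter_sub, bdiff_iter_C_mul, hB, hB', Nat.factorial_succ, Nat.cast_mul, C_mul,
        sub_self]
  have h2 : ∀ n k, (G n k).eval (a k) = if n = 0 then 1 else 0 := by
    intro n k
    obtain ⟨-, hA, hB⟩ := hG n k
    rcases Nat.eq_zero_or_pos n with rfl | hn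
    · have hB0 : G 0 k = C ((Nat.factorial 0 : ℕ) : F) := hB
      rw [hB0]; simp
    · rw [if_neg (by omega)]
      exact hA 0 hn
  refine ⟨h1, h2, ?_⟩
  intro f hd hf hf0 n
  induction n with
  | zero =>
    intro k
    have e := hf0 0 k
    have e' := h2 0 k
    rw [eq_C_of_natDegree_le_zero (hd 0 k)] at e ⊢
    rw [eq_C_of_natDegree_le_zero (hG 0 k).1] at e' ⊢
    rw [eval_C] at e e'
    rw [e, e']
  | succ n ih =>
    intro k
    rw [← sub_eq_zero]
    apply eq_zero_of_bdiff _ (a k)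
    · rw [bdiff_sub, hf _ (by omega), h1 _ (by omega), Nat.add_sub_cancel, ih, sub_self]
    · rw [eval_sub, hf0, h2, sub_self]
end

section
/- (Lattice path / bounded sequence count) Let x and n be positive integers and let a_0 ≤ a_1 ≤ ⋯ ≤ a_{n−1} be integers with 0 ≤ a_i ≤ x for all i. Let LP_n(a_0, …, a_{n−1}) be the number of integer sequences (x_0, x_1, …, x_{n−1}) with 0 ≤ x_0 ≤ x_1 ≤ ⋯ ≤ x_{n−1} and x_i < a_i for all 0 ≤ i ≤ n−1. Then LP_n(a_0, …, a_{n−1}) = (1/n!) · g̃_n(x; x−a_0, x−a_1, …, x−a_{n−1}) = (1/n!) · g̃_n(0; −a_0, −a_1, …, −a_{n−1}), where g̃_n denotes the difference Gončarov polynomial over ℚ (integer nodes regarded as rationals) and g̃_n(c; …) denotes evaluation at c. -/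
open Polynomial Finset

/-- Non-decreasing sequences bounded below by `t` and strictly above by `a`. -/
def seqSet (n : ℕ) (a : ℕ → ℤ) (t : ℤ) : Set (Fin n → ℤ) :=
  {f | Monotone f ∧ ∀ i, t ≤ f i ∧ f i < a (i : ℕ)}

theorem seqSet_finite (n : ℕ) (a : ℕ → ℤ) (t : ℤ) : (seqSet n a t).Finite := by
  apply (Set.finite_Icc (fun _ : Fin n => t) (fun i : Fin n => a i)).subset
  intro f hf
  exact ⟨fun i => (hf.2 i).1, fun i => (hf.2 i).2.le⟩

theorem seqSet_succ (n : ℕ) (a : ℕ → ℤ) (t : ℤ) (ht : t < a 0) :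
    seqSet (n + 1) a t = seqSet (n + 1) a (t + 1) ∪
      (Fin.cons (α := fun _ => ℤ) t) '' seqSet n (fun i => a (i + 1)) t := by
  ext f
  constructor
  · rintro ⟨hm, hf⟩
    by_cases h0 : f 0 = t
    · right
      refine ⟨Fin.tail f, ⟨fun i j hij => hm (Fin.succ_le_succ_iff.2 hij), fun i => ?_⟩, ?_⟩
      · have := hf i.succ
        simpa [Fin.tail] using this
      · rw [← h0]; exact Fin.cons_self_tail f
    · left
      refine ⟨hm, fun i => ⟨?_, (hf i).2⟩⟩
      have h1 := (hf 0).1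
      have h2 := hm (Fin.zero_le i)
      omega
  · rintro (⟨hm, hf⟩ | ⟨f, ⟨hm, hf⟩, rfl⟩)
    · exact ⟨hm, fun i => ⟨by have := (hf i).1; omega, (hf i).2⟩⟩
    · refine ⟨?_, ?_⟩
      · intro i j hij
        induction i using Fin.cases with
        | zero =>
          induction j using Fin.cases with
          | zero => simp
          | succ j => simpa using (hf j).1
        | succ i =>
          induction j using Fin.cases with
          | zero => simp at hij
          | succ j => simpa using hm (Fin.succ_le_succ_iff.1 hij)
      · intro i
        induction i using Fin.cases with
        | zero => simpa using ht
        | succ i => simpa using hf i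

theorem seqSet_ncard_succ (n : ℕ) (a : ℕ → ℤ) (t : ℤ) (ht : t < a 0) :
    (seqSet (n + 1) a t).ncard = (seqSet (n + 1) a (t + 1)).ncard +
      (seqSet n (fun i => a (i + 1)) t).ncard := by
  rw [seqSet_succ n a t ht, Set.ncard_union_eq _ (seqSet_finite _ _ _)
    ((seqSet_finite _ _ _).image _), Set.ncard_image_of_injective _ (Fin.cons_right_injective _)]
  rw [Set.disjoint_left]
  rintro _ ⟨_, h⟩ ⟨f, _, rfl⟩
  have := (h 0).1
  simp at this

theorem seq_main (y c : ℚ) (n : ℕ) : ∀ (a : ℕ → ℤ) (h : ℚ[X]),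
    (∀ i j : ℕ, i ≤ j → j < n → a i ≤ a j) →
    (∀ s < n, (bdiff^[s] h).eval (y - (a s : ℚ)) = 0) → bdiff^[n] h = C c →
    ∀ t : ℤ, (∀ i < n, t ≤ a i) → h.eval (y - (t : ℚ)) = c * ((seqSet n a t).ncard : ℚ) := by
  induction n with
  | zero =>
    intro a h _ _ hc t _
    have : seqSet 0 a t = Set.univ := by
      ext f
      simp [seqSet, Subsingleton.monotone]
    simp only [Function.iterate_zero, id] at hc
    rw [this, hc]
    simp [Set.ncard_univ]
  | succ n ih =>
    intro a h hm hz hc t ht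
    have ih' := ih (fun i => a (i + 1)) (bdiff h)
      (fun i j hij hj => hm _ _ (by omega) (by omega))
      (fun s hs => by simpa using hz (s + 1) (by omega)) (by simpa using hc)
    obtain ⟨k, hk⟩ : ∃ k : ℕ, a 0 = t + k :=
      ⟨(a 0 - t).toNat, by have := ht 0 (by omega); omega⟩
    clear ht
    induction k generalizing t with
    | zero =>
      have e : seqSet (n + 1) a t = ∅ := by
        ext f
        simp only [Set.mem_empty_iff_false, iff_false]
        rintro ⟨_, hf⟩
        have := hf 0
        simp at this
        omega
      have h0 := hz 0 (by omega)
      have : a 0 = t := by simpa using hk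
      rw [e]
      simpa [this] using h0
    | succ k ihk =>
      have h1 := ihk (t + 1) (by push_cast at hk; omega)
      have h2 := ih' t (fun i hi => by
        have := hm 0 (i + 1) (by omega) (by omega)
        omega)
      rw [seqSet_ncard_succ n a t (by omega)]
      simp only [bdiff, eval_sub, eval_comp, eval_X, eval_C] at h2
      push_cast at h1 ⊢
      rw [show y - ((t : ℚ) + 1) = y - t - 1 by ring] at h1
      rw [mul_add, ← h1, ← h2]
      ring

/-- **Lattice paths / bounded non-decreasing sequences.** Let `x, n` be positive
integers and `a_0 ≤ a_1 ≤ ⋯ ≤ a_{n-1}` integers with `0 ≤ a_i ≤ x`.  The number of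
non-decreasing integer sequences `0 ≤ x_0 ≤ x_1 ≤ ⋯ ≤ x_{n-1}` with `x_i < a_i`
for all `i` equals `(1/n!) · g̃_n(x; x - a_0, …, x - a_{n-1})`, and also equals
`(1/n!) · g̃_n(0; -a_0, …, -a_{n-1})`, where the Gončarov polynomials are taken
over `ℚ`. -/
theorem lattice_path_count (x n : ℕ) (hx : 0 < x) (hn : 0 < n) (a : ℕ → ℤ)
    (hbd : ∀ i < n, 0 ≤ a i ∧ a i ≤ (x : ℤ))
    (hmono : ∀ i j : ℕ, i ≤ j → j < n → a i ≤ a j)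
    (g g₀ : ℚ[X])
    (hg : IsDiffGoncarov n (fun i => (x : ℚ) - (a i : ℚ)) g)
    (hg₀ : IsDiffGoncarov n (fun i => -(a i : ℚ)) g₀) :
    (Nat.card {f : Fin n → ℤ // Monotone f ∧ ∀ i, 0 ≤ f i ∧ f i < a (i : ℕ)} : ℚ) =
        (n.factorial : ℚ)⁻¹ * g.eval (x : ℚ) ∧
    (Nat.card {f : Fin n → ℤ // Monotone f ∧ ∀ i, 0 ≤ f i ∧ f i < a (i : ℕ)} : ℚ) =
        (n.factorial : ℚ)⁻¹ * g₀.eval 0 := by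
  have hf : (n.factorial : ℚ) ≠ 0 := by exact_mod_cast n.factorial_ne_zero
  have e : Nat.card {f : Fin n → ℤ // Monotone f ∧ ∀ i, 0 ≤ f i ∧ f i < a (i : ℕ)}
      = (seqSet n a 0).ncard := rfl
  rw [e]
  constructor
  · have := seq_main x n.factorial n a g hmono hg.2.1 hg.2.2 0 (fun i hi => (hbd i hi).1)
    simp only [Int.cast_zero, sub_zero] at this
    rw [this, inv_mul_cancel_left₀ hf]
  · have := seq_main 0 n.factorial n a g₀ hmono
      (fun s hs => by rw [zero_sub]; exact hg₀.2.1 s hs) hg₀.2.2 0 (fun i hi => (hbd i hi).1)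
    simp only [Int.cast_zero, sub_zero] at this
    rw [this, inv_mul_cancel_left₀ hf]
end

section
/- (General difference formula) Let Z be a node set, m, n ∈ ℕ, and let i ≤ m, j ≤ n. Then Δ_x^i Δ_y^j g̃_{m,n}((x,y); Z) = (m)_i · (n)_j · g̃_{m−i, n−j}((x,y); L^i D^j Z), where (t)_k = t(t−1)⋯(t−k+1) is the k-th lower (falling) factorial and L^i D^j Z is the node set whose (k,l)-node is z_{k+i, l+j}. -/
open Finset

namespace GonAux

open MvPolynomial

noncomputable def shAlg {F : Type*} [Field F] (v : Fin 2) :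
    MvPolynomial (Fin 2) F →ₐ[F] MvPolynomial (Fin 2) F :=
  MvPolynomial.aeval (fun u => if u = v then MvPolynomial.X u - 1 else MvPolynomial.X u)

noncomputable def dl {F : Type*} [Field F] (v : Fin 2) :
    Module.End F (MvPolynomial (Fin 2) F) :=
  1 - (shAlg v).toLinearMap

lemma dl_apply {F : Type*} [Field F] (v : Fin 2) (p : MvPolynomial (Fin 2) F) :
    dl v p = p - shAlg v p := rfl

lemma bdiffx_eq {F : Type*} [Field F] :
    (bdiffx : MvPolynomial (Fin 2) F → _) = dl 0 := by
  funext p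
  rw [dl_apply, bdiffx, shAlg]
  congr 3
  funext u
  fin_cases u <;> simp

lemma bdiffy_eq {F : Type*} [Field F] :
    (bdiffy : MvPolynomial (Fin 2) F → _) = dl 1 := by
  funext p
  rw [dl_apply, bdiffy, shAlg]
  congr 3
  funext u
  fin_cases u <;> simp

lemma sh_comm {F : Type*} [Field F] :
    (shAlg (F := F) 0).comp (shAlg 1) = (shAlg 1).comp (shAlg 0) := by
  apply MvPolynomial.algHom_ext
  intro u
  fin_cases u <;> simp [shAlg]

lemma dl_comm {F : Type*} [Field F] : Commute (dl (F := F) 0) (dl 1) := by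
  refine LinearMap.ext fun p => ?_
  have := DFunLike.congr_fun (sh_comm (F := F)) p
  simp only [AlgHom.comp_apply] at this
  simp only [Module.End.mul_apply, dl_apply, map_sub, this]
  abel

lemma dl_monomial {F : Type*} [Field F] (v : Fin 2) (s : Fin 2 →₀ ℕ) (c : F) :
    dl v (monomial s c) = monomial (s.erase v) c * (X v ^ s v - (X v - 1) ^ s v) := by
  have h1 : monomial s c = monomial (s.erase v) c * X v ^ s v := by
    rw [X_pow_eq_monomial, monomial_mul, Finsupp.erase_add_single, mul_one]
  have h2 : shAlg v (monomial (s.erase v) c) = monomial (s.erase v) c := by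
    rw [shAlg, aeval_monomial, monomial_eq, Finsupp.prod_fintype _ _ (by simp),
      Finsupp.prod_fintype _ _ (by simp), algebraMap_eq]
    fin_cases v <;> simp
  have h3 : shAlg v (X v : MvPolynomial (Fin 2) F) = X v - 1 := by simp [shAlg]
  rw [dl_apply, h1, map_mul, h2, map_pow, h3, mul_sub]

lemma deg_sub {F : Type*} [Field F] (v : Fin 2) :
    degreeOf v (X v - 1 : MvPolynomial (Fin 2) F) ≤ 1 := by
  refine (degreeOf_sub_le _ _ _).trans ?_
  simp [degreeOf_X]

lemma deg_pow_sub {F : Type*} [Field F] (v : Fin 2) (a : ℕ) :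
    degreeOf v (X v ^ a - (X v - 1) ^ a : MvPolynomial (Fin 2) F) ≤ a - 1 := by
  induction a with
  | zero => simp
  | succ a ih =>
    have : (X v ^ (a+1) - (X v - 1) ^ (a+1) : MvPolynomial (Fin 2) F)
      = X v * (X v ^ a - (X v - 1) ^ a) + (X v - 1) ^ a := by ring
    rw [this]
    refine (degreeOf_add_le _ _ _).trans (max_le ?_ ?_)
    · rcases a with _ | a
      · simp
      · refine (degreeOf_mul_le _ _ _).trans ?_
        simp only [degreeOf_X, if_true]
        omega
    · refine (degreeOf_pow_le _ _ _).trans ?_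
      have := Nat.mul_le_mul_left a (deg_sub (F := F) v)
      omega

lemma deg_pow_sub_other {F : Type*} [Field F] (v w : Fin 2) (hw : w ≠ v) (a : ℕ) :
    degreeOf w (X v ^ a - (X v - 1) ^ a : MvPolynomial (Fin 2) F) ≤ 0 := by
  have h1 : degreeOf w (X v : MvPolynomial (Fin 2) F) = 0 := by
    simp [degreeOf_X, hw]
  have h2 : degreeOf w (X v - 1 : MvPolynomial (Fin 2) F) ≤ 0 := by
    refine (degreeOf_sub_le _ _ _).trans ?_
    simp [h1]
  refine (degreeOf_sub_le _ _ _).trans (max_le ?_ ?_)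
  · refine (degreeOf_pow_le _ _ _).trans ?_
    simp [h1]
  · refine (degreeOf_pow_le _ _ _).trans ?_
    have := Nat.mul_le_mul_left a h2
    omega

lemma deg_monomial_le {F : Type*} [Field F] (v : Fin 2) (s : Fin 2 →₀ ℕ) (c : F) :
    degreeOf v (monomial s c) ≤ s v := by
  by_cases hc : c = 0
  · simp [hc]
  · rw [degreeOf_monomial_eq _ _ hc]

lemma dl_sum {F : Type*} [Field F] (v : Fin 2) (p : MvPolynomial (Fin 2) F) :
    dl v p = ∑ s ∈ p.support, dl v (monomial s (coeff s p)) := by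
  conv_lhs => rw [p.as_sum, map_sum]

lemma deg_dl_self {F : Type*} [Field F] (v : Fin 2) (p : MvPolynomial (Fin 2) F) (m : ℕ)
    (h : degreeOf v p ≤ m) : degreeOf v (dl v p) ≤ m - 1 := by
  rw [dl_sum]
  refine (degreeOf_sum_le _ _ _).trans (Finset.sup_le fun s hs => ?_)
  rw [dl_monomial]
  refine (degreeOf_mul_le _ _ _).trans ?_
  have h1 := deg_monomial_le v (s.erase v) (coeff s p)
  have h2 := deg_pow_sub (F := F) v (s v)
  have h3 := degreeOf_le_iff.1 h s hs
  rw [Finsupp.erase_same] at h1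
  omega

lemma deg_dl_other {F : Type*} [Field F] (v w : Fin 2) (hw : w ≠ v)
    (p : MvPolynomial (Fin 2) F) (m : ℕ)
    (h : degreeOf w p ≤ m) : degreeOf w (dl v p) ≤ m := by
  rw [dl_sum]
  refine (degreeOf_sum_le _ _ _).trans (Finset.sup_le fun s hs => ?_)
  rw [dl_monomial]
  refine (degreeOf_mul_le _ _ _).trans ?_
  have h1 := deg_monomial_le w (s.erase v) (coeff s p)
  have h2 := deg_pow_sub_other (F := F) v w hw (s v)
  have h3 := degreeOf_le_iff.1 h s hs
  rw [Finsupp.erase_ne hw] at h1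
  omega

lemma dl_eq_zero {F : Type*} [Field F] (v : Fin 2) (p : MvPolynomial (Fin 2) F)
    (h : degreeOf v p ≤ 0) : dl v p = 0 := by
  rw [dl_sum]
  refine Finset.sum_eq_zero fun s hs => ?_
  have h3 := Nat.le_zero.1 (degreeOf_le_iff.1 h s hs)
  rw [dl_monomial, h3]
  simp

lemma eval_sh {F : Type*} [Field F] (v : Fin 2) (p : MvPolynomial (Fin 2) F) (x : Fin 2 → F) :
    eval x (shAlg v p) = eval (fun u => if u = v then x u - 1 else x u) p := by
  induction p using MvPolynomial.induction_on with
  | C a => simp [shAlg]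
  | add p q hp hq => simp [hp, hq]
  | mul_X p u hp =>
    rw [map_mul, map_mul, hp, map_mul]
    congr 1
    by_cases h : u = v <;> simp [shAlg, h]

lemma const_of_dl {F : Type*} [Field F] [CharZero F] (p : MvPolynomial (Fin 2) F)
    (hx : dl 0 p = 0) (hy : dl 1 p = 0) (z : Fin 2 → F) (hz : eval z p = 0) : p = 0 := by
  have hx' : ∀ x y : F, eval ![x - 1, y] p = eval ![x, y] p := by
    intro x y
    have := congrArg (eval ![x, y]) hx
    rw [dl_apply, map_sub, eval_sh, map_zero, sub_eq_zero] at this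
    rw [this]
    congr 2
    funext u
    fin_cases u <;> simp
  have hy' : ∀ x y : F, eval ![x, y - 1] p = eval ![x, y] p := by
    intro x y
    have := congrArg (eval ![x, y]) hy
    rw [dl_apply, map_sub, eval_sh, map_zero, sub_eq_zero] at this
    rw [this]
    congr 2
    funext u
    fin_cases u <;> simp
  have key : ∀ a b : ℕ, eval ![z 0 - a, z 1 - b] p = 0 := by
    intro a b
    induction a with
    | zero =>
      induction b with
      | zero =>
        rw [← hz]
        congr 2
        funext u
        fin_cases u <;> simp
      | succ b ih =>
        rw [← ih, ← hy' _ (z 1 - (b : F))]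
        congr 3
        push_cast
        ring_nf
    | succ a ih =>
      rw [← ih, ← hx' (z 0 - (a : F))]
      congr 3
      push_cast
      ring
  have hinj : ∀ u : Fin 2, Function.Injective (fun a : ℕ => z u - (a : F)) := by
    intro u a b h
    simpa using h
  refine MvPolynomial.funext_set (fun u => Set.range (fun a : ℕ => z u - (a : F)))
    (fun u => Set.infinite_range_of_injective (hinj u)) ?_
  intro x hx
  obtain ⟨a, ha⟩ := hx 0 (Set.mem_univ _)
  obtain ⟨b, hb⟩ := hx 1 (Set.mem_univ _)
  rw [map_zero, ← key a b]
  congr 2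
  funext u
  fin_cases u
  · simpa using ha.symm
  · simpa using hb.symm

lemma uniq {F : Type*} [Field F] [CharZero F] (N : ℕ) : ∀ (m n : ℕ) (_ : m + n ≤ N)
    (Z : ℕ → ℕ → Fin 2 → F) (h : MvPolynomial (Fin 2) F)
    (_ : degreeOf 0 h ≤ m) (_ : degreeOf 1 h ≤ n)
    (_ : ∀ i ≤ m, ∀ j ≤ n, eval (Z i j) (((dl 0) ^ i * (dl 1) ^ j : Module.End F _) h) = 0),
    h = 0 := by
  induction N with
  | zero =>
    intro m n hN Z h hm hn hZ
    obtain ⟨rfl, rfl⟩ : m = 0 ∧ n = 0 := by omega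
    refine const_of_dl h (dl_eq_zero _ _ hm) (dl_eq_zero _ _ hn) (Z 0 0) ?_
    simpa using hZ 0 le_rfl 0 le_rfl
  | succ N ih =>
    intro m n hN Z h hm hn hZ
    refine const_of_dl h ?_ ?_ (Z 0 0) (by simpa using hZ 0 (zero_le) 0 (zero_le))
    · rcases m with _ | m
      · exact dl_eq_zero _ _ hm
      · refine ih m n (by omega) (fun i j => Z (i+1) j) _ (deg_dl_self _ _ _ hm)
          (deg_dl_other _ _ (by decide) _ _ hn) ?_
        intro i hi j hj
        rw [← hZ (i+1) (by omega) j hj, ← Module.End.mul_apply, mul_assoc,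
          ← (dl_comm.pow_right j).eq, ← mul_assoc, pow_succ]
    · rcases n with _ | n
      · exact dl_eq_zero _ _ hn
      · refine ih m n (by omega) (fun i j => Z i (j+1)) _ 
          (deg_dl_other _ _ (by decide) _ _ hm) (deg_dl_self _ _ _ hn) ?_
        intro i hi j hj
        rw [← hZ i hi (j+1) (by omega), ← Module.End.mul_apply, mul_assoc, pow_succ]

lemma deg_pow_self {F : Type*} [Field F] (v : Fin 2) (p : MvPolynomial (Fin 2) F) (m i : ℕ)
    (h : degreeOf v p ≤ m) : degreeOf v ((dl v ^ i) p) ≤ m - i := by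
  induction i with
  | zero => simpa using h
  | succ i ih =>
    rw [pow_succ', Module.End.mul_apply]
    exact deg_dl_self _ _ _ ih

lemma deg_pow_other {F : Type*} [Field F] (v w : Fin 2) (hw : w ≠ v)
    (p : MvPolynomial (Fin 2) F) (m i : ℕ)
    (h : degreeOf w p ≤ m) : degreeOf w ((dl v ^ i) p) ≤ m := by
  induction i with
  | zero => simpa using h
  | succ i ih =>
    rw [pow_succ', Module.End.mul_apply]
    exact deg_dl_other _ _ hw _ _ ih

end GonAux

/-- **General difference formula.** For `i ≤ m`, `j ≤ n`,
`Δ_x^i Δ_y^j g̃_{m,n}((x,y); Z) = (m)_i · (n)_j · g̃_{m-i,n-j}((x,y); L^i D^j Z)`,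
where `(t)_k` is the falling factorial and `L^i D^j Z` is the node set whose
`(k,l)`-node is `z_{k+i,l+j}`. -/
theorem general_difference_formula (F : Type*) [Field F] [CharZero F]
    (m n i j : ℕ) (hi : i ≤ m) (hj : j ≤ n)
    (Z : ℕ → ℕ → F × F) (g g' : MvPolynomial (Fin 2) F)
    (hg : IsDiffGoncarov2 m n Z g)
    (hg' : IsDiffGoncarov2 (m - i) (n - j) (fun k l => Z (k + i) (l + j)) g') :
    bdiffx^[i] (bdiffy^[j] g) =
      MvPolynomial.C ((m.descFactorial i : F) * (n.descFactorial j : F)) * g' := by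
  obtain ⟨h1, h2, h3⟩ := hg
  obtain ⟨h1', h2', h3'⟩ := hg'
  simp only [GonAux.bdiffx_eq, GonAux.bdiffy_eq, ← Module.End.pow_apply] at h3 h3' ⊢
  rw [← sub_eq_zero]
  refine GonAux.uniq _ (m - i) (n - j) le_rfl
    (fun k l => ![(Z (k+i) (l+j)).1, (Z (k+i) (l+j)).2]) _ ?_ ?_ ?_
  · refine (MvPolynomial.degreeOf_sub_le _ _ _).trans (max_le ?_ ?_)
    · exact GonAux.deg_pow_self _ _ _ _ (GonAux.deg_pow_other _ _ (by decide) _ _ _ h1)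
    · exact (MvPolynomial.degreeOf_C_mul_le _ _ _).trans h1'
  · refine (MvPolynomial.degreeOf_sub_le _ _ _).trans (max_le ?_ ?_)
    · exact GonAux.deg_pow_other _ _ (by decide) _ _ _ (GonAux.deg_pow_self _ _ _ _ h2)
    · exact (MvPolynomial.degreeOf_C_mul_le _ _ _).trans h2'
  · intro k hk l hl
    have e1 := h3 (k+i) (by omega) (l+j) (by omega)
    have e2 := h3' k hk l hl
    have c := ((GonAux.dl_comm (F := F)).pow_pow i l).eq
    have e3 : (GonAux.dl 0 ^ k * GonAux.dl 1 ^ l : Module.End F _)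
        ((GonAux.dl 0 ^ i) ((GonAux.dl 1 ^ j) g)) =
        (GonAux.dl 0 ^ (k+i)) ((GonAux.dl 1 ^ (l+j)) g) := by
      simp only [← Module.End.mul_apply]
      congr 1
      rw [pow_add, pow_add, mul_assoc, ← mul_assoc (GonAux.dl 1 ^ l), ← c]
      simp only [mul_assoc]
    rw [map_sub, map_sub, e3, e1, ← MvPolynomial.smul_eq_C_mul, map_smul, MvPolynomial.smul_eval,
      Module.End.mul_apply, e2]
    have hm := Nat.factorial_mul_descFactorial hi
    have hn := Nat.factorial_mul_descFactorial hj
    have hiff : (k + i = m ∧ l + j = n) ↔ (k = m - i ∧ l = n - j) := by omega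
    simp only [hiff]
    split_ifs
    · rw [← hm, ← hn]
      push_cast
      ring
    · simp
end

section
/- (Bivariate shift-invariant formula) Let Z = {z_{i,j} = (x_{i,j}, y_{i,j})} be a node set and ξ, η ∈ F, and let Z + (ξ,η) denote the node set with (i,j)-node (x_{i,j} + ξ, y_{i,j} + η). Then g̃_{m,n}((x + ξ, y + η); Z + (ξ,η)) = g̃_{m,n}((x,y); Z) as polynomials in x and y; that is, substituting x ↦ x + ξ, y ↦ y + η into g̃_{m,n}((x,y); Z + (ξ,η)) yields g̃_{m,n}((x,y); Z). -/
open Finset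

open MvPolynomial in
theorem gs_evalx {F : Type*} [Field F] (x y : F) (q : MvPolynomial (Fin 2) F) :
    eval ![x, y] (bdiffx q) = eval ![x, y] q - eval ![x - 1, y] q := by
  unfold bdiffx
  rw [map_sub]
  congr 1
  induction q using MvPolynomial.induction_on with
  | C a => simp
  | add p q hp hq => simp only [map_add, hp, hq]
  | mul_X p i hp =>
    simp only [map_mul, hp]
    fin_cases i <;> simp

open MvPolynomial in
theorem gs_evaly {F : Type*} [Field F] (x y : F) (q : MvPolynomial (Fin 2) F) :
    eval ![x, y] (bdiffy q) = eval ![x, y] q - eval ![x, y - 1] q := by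
  unfold bdiffy
  rw [map_sub]
  congr 1
  induction q using MvPolynomial.induction_on with
  | C a => simp
  | add p q hp hq => simp only [map_add, hp, hq]
  | mul_X p i hp =>
    simp only [map_mul, hp]
    fin_cases i <;> simp

open MvPolynomial in
theorem gs_iterx {F : Type*} [Field F] (i : ℕ) (x y : F) (q : MvPolynomial (Fin 2) F) :
    eval ![x, y] (bdiffx^[i] q) = (fwdDiff 1)^[i] (fun t => eval ![t, y] q) (x - i) := by
  induction i generalizing x with
  | zero => simp
  | succ i ih =>
    rw [Function.iterate_succ_apply', Function.iterate_succ_apply', gs_evalx, ih, ih, fwdDiff]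
    congr 2 <;> push_cast <;> ring_nf

open MvPolynomial in
theorem gs_itery {F : Type*} [Field F] (i : ℕ) (x y : F) (q : MvPolynomial (Fin 2) F) :
    eval ![x, y] (bdiffy^[i] q) = (fwdDiff 1)^[i] (fun t => eval ![x, t] q) (y - i) := by
  induction i generalizing y with
  | zero => simp
  | succ i ih =>
    rw [Function.iterate_succ_apply', Function.iterate_succ_apply', gs_evaly, ih, ih, fwdDiff]
    congr 2 <;> push_cast <;> ring_nf

open MvPolynomial in
theorem gs_mono {F : Type*} [Field F] (i j : ℕ) (x y : F) (s : Fin 2 →₀ ℕ) (c : F) :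
    eval ![x, y] (bdiffx^[i] (bdiffy^[j] (monomial s c))) =
      c * (fwdDiff 1)^[j] (fun t : F => t ^ (s 1)) (y - j) *
        (fwdDiff 1)^[i] (fun t : F => t ^ (s 0)) (x - i) := by
  rw [gs_iterx]
  have h : (fun t => eval ![t, y] (bdiffy^[j] (monomial s c))) =
      (c * (fwdDiff 1)^[j] (fun t : F => t ^ (s 1)) (y - j)) • (fun t : F => t ^ (s 0)) := by
    funext t
    rw [gs_itery]
    have h2 : (fun u => eval ![t, u] (monomial s c)) =
        (c * t ^ (s 0)) • (fun u : F => u ^ (s 1)) := by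
      funext u
      rw [eval_monomial, Finsupp.prod_fintype _ _ (by simp)]
      simp [Fin.prod_univ_two]
      ring
    rw [h2, fwdDiff_iter_const_smul]
    simp
    ring
  rw [h, fwdDiff_iter_const_smul]
  simp

/-- Linear version of the x difference. -/
noncomputable def gsDx (F : Type*) [Field F] : Module.End F (MvPolynomial (Fin 2) F) :=
  LinearMap.id - (MvPolynomial.aeval ![MvPolynomial.X 0 - 1, MvPolynomial.X 1]).toLinearMap

/-- Linear version of the y difference. -/
noncomputable def gsDy (F : Type*) [Field F] : Module.End F (MvPolynomial (Fin 2) F) :=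
  LinearMap.id - (MvPolynomial.aeval ![MvPolynomial.X 0, MvPolynomial.X 1 - 1]).toLinearMap

theorem gs_dx (F : Type*) [Field F] (i : ℕ) (p : MvPolynomial (Fin 2) F) :
    bdiffx^[i] p = (gsDx F ^ i) p := by
  rw [Module.End.pow_apply]; rfl

theorem gs_dy (F : Type*) [Field F] (i : ℕ) (p : MvPolynomial (Fin 2) F) :
    bdiffy^[i] p = (gsDy F ^ i) p := by
  rw [Module.End.pow_apply]; rfl

open MvPolynomial in
theorem gs_unique {F : Type*} [Field F] [CharZero F] (m n : ℕ) (Z : ℕ → ℕ → F × F)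
    (p : MvPolynomial (Fin 2) F) (h0 : p.degreeOf 0 ≤ m) (h1 : p.degreeOf 1 ≤ n)
    (h : ∀ i ≤ m, ∀ j ≤ n,
      eval ![(Z i j).1, (Z i j).2] (bdiffx^[i] (bdiffy^[j] p)) = 0) : p = 0 := by
  by_contra hp
  obtain ⟨s, hs⟩ := p.support.exists_maximal (support_nonempty.mpr hp)
  have hs0 := degreeOf_le_iff.mp h0 s hs.1
  have hs1 := degreeOf_le_iff.mp h1 s hs.1
  have key := h _ hs0 _ hs1
  generalize (Z (s 0) (s 1)).1 = x at key
  generalize (Z (s 0) (s 1)).2 = y at key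
  rw [p.as_sum] at key
  simp only [gs_dx, gs_dy, map_sum] at key
  simp only [← gs_dx, ← gs_dy, gs_mono] at key
  rw [Finset.sum_eq_single s] at key
  · rw [fwdDiff_iter_eq_factorial, fwdDiff_iter_eq_factorial] at key
    have := mem_support_iff.mp hs.1
    have f0 : ((s 0).factorial : F) ≠ 0 := by exact_mod_cast (s 0).factorial_ne_zero
    have f1 : ((s 1).factorial : F) ≠ 0 := by exact_mod_cast (s 1).factorial_ne_zero
    exact mul_ne_zero (mul_ne_zero this f1) f0 key
  · intro t ht hts
    by_cases c0 : t 0 < s 0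
    · rw [fwdDiff_iter_pow_eq_zero_of_lt c0]; simp
    by_cases c1 : t 1 < s 1
    · rw [fwdDiff_iter_pow_eq_zero_of_lt c1]; simp
    exfalso
    have hle : s ≤ t := by
      intro k
      fin_cases k
      · exact not_lt.mp c0
      · exact not_lt.mp c1
    exact hts (le_antisymm (hs.2 ht hle) hle)
  · intro hn
    exact absurd hs.1 hn

open MvPolynomial in
theorem gs_evalT {F : Type*} [Field F] (ξ η x y : F) (q : MvPolynomial (Fin 2) F) :
    eval ![x, y] (aeval ![(X 0 + C ξ : MvPolynomial (Fin 2) F), X 1 + C η] q) =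
      eval ![x + ξ, y + η] q := by
  induction q using MvPolynomial.induction_on with
  | C a => simp
  | add p q hp hq => simp only [map_add, hp, hq]
  | mul_X p i hp =>
    simp only [map_mul, hp]
    fin_cases i <;> simp

open MvPolynomial in
theorem gs_shift {F : Type*} [Field F] (i j : ℕ) (ξ η x y : F) (q : MvPolynomial (Fin 2) F) :
    eval ![x, y] (bdiffx^[i] (bdiffy^[j]
      (aeval ![(X 0 + C ξ : MvPolynomial (Fin 2) F), X 1 + C η] q))) =
      eval ![x + ξ, y + η] (bdiffx^[i] (bdiffy^[j] q)) := by
  simp only [gs_iterx, gs_itery, gs_evalT]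
  have e : ∀ t : F, (fwdDiff 1)^[j] (fun u => eval ![t + ξ, u + η] q) (y - j) =
      (fwdDiff 1)^[j] (fun u => eval ![t + ξ, u] q) (y + η - j) := by
    intro t
    rw [fwdDiff_iter_comp_add 1 (fun u => eval ![t + ξ, u] q)]
    ring_nf
  simp only [e]
  rw [fwdDiff_iter_comp_add 1
    (fun t => (fwdDiff 1)^[j] (fun u => eval ![t, u] q) (y + η - j))]
  ring_nf

open MvPolynomial in
theorem gs_deg {F : Type*} [Field F] (ξ η : F) (k : Fin 2) (q : MvPolynomial (Fin 2) F) :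
    (aeval ![(X 0 + C ξ : MvPolynomial (Fin 2) F), X 1 + C η] q).degreeOf k ≤ q.degreeOf k := by
  have hd : ∀ a b : Fin 2, ∀ c : F, (X b + C c : MvPolynomial (Fin 2) F).degreeOf a ≤
      if a = b then 1 else 0 := by
    intro a b c
    refine (degreeOf_add_le _ _ _).trans ?_
    rw [degreeOf_X, degreeOf_C]; simp
  conv_lhs => rw [q.as_sum, map_sum]
  refine (degreeOf_sum_le _ _ _).trans (Finset.sup_le fun s hs => ?_)
  refine le_trans ?_ (degreeOf_le_iff.mp le_rfl s hs)
  rw [aeval_monomial, Finsupp.prod_fintype _ _ (by simp), Fin.prod_univ_two]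
  simp only [algebraMap_eq]
  refine (degreeOf_C_mul_le _ _ _).trans ((degreeOf_mul_le _ _ _).trans ?_)
  refine (add_le_add (degreeOf_pow_le _ _ _) (degreeOf_pow_le _ _ _)).trans ?_
  have a := Nat.mul_le_mul_left (s 0) (hd k 0 ξ)
  have b := Nat.mul_le_mul_left (s 1) (hd k 1 η)
  refine (add_le_add a b).trans ?_
  fin_cases k <;> simp

/-- **Bivariate shift-invariant formula.** For `ξ, η ∈ F`, substituting
`x ↦ x + ξ`, `y ↦ y + η` into `g̃_{m,n}((x,y); Z + (ξ,η))` yields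
`g̃_{m,n}((x,y); Z)`, where `Z + (ξ,η)` is the node set with `(i,j)`-node
`(x_{i,j} + ξ, y_{i,j} + η)`. -/
theorem bivariate_shift_invariant (F : Type*) [Field F] [CharZero F]
    (m n : ℕ) (Z : ℕ → ℕ → F × F) (ξ η : F) (g g' : MvPolynomial (Fin 2) F)
    (hg : IsDiffGoncarov2 m n Z g)
    (hg' : IsDiffGoncarov2 m n (fun i j => ((Z i j).1 + ξ, (Z i j).2 + η)) g') :
    MvPolynomial.aeval
        ![MvPolynomial.X 0 + MvPolynomial.C ξ, MvPolynomial.X 1 + MvPolynomial.C η] g' =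
      g := by
  rw [← sub_eq_zero]
  obtain ⟨a0, a1, a2⟩ := hg
  obtain ⟨b0, b1, b2⟩ := hg'
  apply gs_unique m n Z
  · exact (MvPolynomial.degreeOf_sub_le _ _ _).trans (max_le ((gs_deg _ _ _ _).trans b0) a0)
  · exact (MvPolynomial.degreeOf_sub_le _ _ _).trans (max_le ((gs_deg _ _ _ _).trans b1) a1)
  · intro i hi j hj
    have e1 := a2 i hi j hj
    have e2 := b2 i hi j hj
    rw [← gs_shift] at e2
    simp only [gs_dx, gs_dy, map_sub] at e1 e2 ⊢
    rw [e1, e2, sub_self]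
end
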